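/- Let g be a Lie 2-algebra over a field k. Then Der⁰(g), equipped with the bracket [(X,l_X),(Y,l_Y)]_Der = ([X,Y]_C, l_{[X,Y]_C}), is a Lie algebra; in particular, for all (X,l_X), (Y,l_Y), (Z,l_Z) ∈ Der⁰(g) one has l_{[X,[Y,Z]_C]_C} + l_{[Y,[Z,X]_C]_C} + l_{[Z,[X,Y]_C]_C} = 0. -/

import Mathlib

/-- A Lie 2-algebra: a 2-term complex `d : g1 → g0` with a skew-symmetric bracket
(`br0` on degree 0, `br1` mixing degrees, with `[a,x] := -[x,a]`) and an alternating
Jacobiator `l3`, satisfying the Lie 2-algebra axioms. -/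
structure LieTwo (k : Type*) (g0 : Type*) (g1 : Type*) [Field k]
    [AddCommGroup g0] [Module k g0] [AddCommGroup g1] [Module k g1] where
  d : g1 →ₗ[k] g0
  br0 : g0 →ₗ[k] g0 →ₗ[k] g0
  br1 : g0 →ₗ[k] g1 →ₗ[k] g1
  l3 : g0 →ₗ[k] g0 →ₗ[k] g0 →ₗ[k] g1
  br0_skew : ∀ x y, br0 x y = - br0 y x
  l3_skew12 : ∀ x y z, l3 x y z = - l3 y x z
  l3_skew23 : ∀ x y z, l3 x y z = - l3 x z y
  d_br1 : ∀ x a, d (br1 x a) = br0 x (d a)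
  br1_dd : ∀ a b, br1 (d a) b = - br1 (d b) a
  jac0 : ∀ x y z, br0 x (br0 y z) + br0 y (br0 z x) + br0 z (br0 x y) = d (l3 x y z)
  jac1 : ∀ x y a, br1 x (br1 y a) - br1 y (br1 x a) - br1 (br0 x y) a = l3 x y (d a)
  jacobiator : ∀ x y z t,
    l3 (br0 x y) z t + l3 (br0 y z) t x + l3 (br0 z t) x y + l3 (br0 t x) y z
      = - br1 t (l3 x y z) - br1 x (l3 y z t) - br1 y (l3 z t x) - br1 z (l3 t x y)

namespace LieTwo

variable {k g0 g1 : Type*} [Field k] [AddCommGroup g0] [Module k g0]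
  [AddCommGroup g1] [Module k g1]

/-- A derivation of degree 0 of a Lie 2-algebra: a pair `(X, l_X)` with
`X = (X0, X1)`, `X0 ∘ d = d ∘ X1`, `l_X` skew-symmetric, satisfying (a), (b), (c). -/
structure Der0 (T : LieTwo k g0 g1) where
  X0 : g0 →ₗ[k] g0
  X1 : g1 →ₗ[k] g1
  lX : g0 →ₗ[k] g0 →ₗ[k] g1
  compat : ∀ a, X0 (T.d a) = T.d (X1 a)
  lX_skew : ∀ x y, lX x y = - lX y x
  conda : ∀ x y, X0 (T.br0 x y) - T.br0 (X0 x) y - T.br0 x (X0 y) = T.d (lX x y)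
  condb : ∀ x a, X1 (T.br1 x a) - T.br1 (X0 x) a - T.br1 x (X1 a) = lX x (T.d a)
  condc : ∀ x y z,
    lX x (T.br0 y z) + T.br1 x (lX y z) + T.l3 (X0 x) y z + T.l3 x (X0 y) z
        + T.l3 x y (X0 z)
      = X1 (T.l3 x y z) + lX (T.br0 x y) z + lX y (T.br0 x z)
        - T.br1 z (lX x y) + T.br1 y (lX x z)

/-- The `l`-component `l_{[X,Y]_C}` of the bracket of two derivation triples
`(X0,X1,lX)` and `(Y0,Y1,lY)`. -/
def lBc (X0 : g0 →ₗ[k] g0) (X1 : g1 →ₗ[k] g1) (lX : g0 →ₗ[k] g0 →ₗ[k] g1)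
    (Y0 : g0 →ₗ[k] g0) (Y1 : g1 →ₗ[k] g1) (lY : g0 →ₗ[k] g0 →ₗ[k] g1) :
    g0 →ₗ[k] g0 →ₗ[k] g1 :=
  lX ∘ₗ Y0 + lX.compl₂ Y0 - lY ∘ₗ X0 - lY.compl₂ X0 + lY.compr₂ X1 - lX.compr₂ Y1

/-- `l_{[X,Y]_C}` for two derivations. -/
def lB {T : LieTwo k g0 g1} (X Y : T.Der0) : g0 →ₗ[k] g0 →ₗ[k] g1 :=
  lBc X.X0 X.X1 X.lX Y.X0 Y.X1 Y.lX

/-- Degree-0 component of the commutator `[X,Y]_C` of two derivations. -/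
def cc0 {T : LieTwo k g0 g1} (X Y : T.Der0) : g0 →ₗ[k] g0 :=
  X.X0 ∘ₗ Y.X0 - Y.X0 ∘ₗ X.X0

/-- Degree-1 component of the commutator `[X,Y]_C` of two derivations. -/
def cc1 {T : LieTwo k g0 g1} (X Y : T.Der0) : g1 →ₗ[k] g1 :=
  X.X1 ∘ₗ Y.X1 - Y.X1 ∘ₗ X.X1

variable (T : LieTwo k g0 g1)

/-- `l_{δ(D)}(x,y) = D[x,y] - [x, D y] + [y, D x]` (where `[Dx,y] = -[y,Dx]`). -/
def lδ (D : g0 →ₗ[k] g1) : g0 →ₗ[k] g0 →ₗ[k] g1 :=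
  T.br0.compr₂ D - T.br1.compl₂ D + (T.br1.compl₂ D).flip

/-- `ad_a : g0 → g1`, `ad_a u = [a,u] = -[u,a]` for `a` of degree 1. -/
def adg1 (a : g1) : g0 →ₗ[k] g1 := - (T.br1.flip a)

/-- Degree-0 `End`-component of `d_D(D,x) = δ(D) + ad_x`. -/
def dd0 (D : g0 →ₗ[k] g1) (x : g0) : g0 →ₗ[k] g0 := T.d ∘ₗ D + T.br0 x

/-- Degree-1 `End`-component of `d_D(D,x) = δ(D) + ad_x`. -/
def dd1 (D : g0 →ₗ[k] g1) (x : g0) : g1 →ₗ[k] g1 := D ∘ₗ T.d + T.br1 x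

/-- `l`-component of `d_D(D,x) = (δ(D) + ad_x, l_{δ(D)} + l3(x,·,·))`. -/
def ddl (D : g0 →ₗ[k] g1) (x : g0) : g0 →ₗ[k] g0 →ₗ[k] g1 := T.lδ D + T.l3 x

/-- `⟦(D,x),(D',x')⟧ = -D x' - D' x`. -/
def brDD (D : g0 →ₗ[k] g1) (x : g0) (D' : g0 →ₗ[k] g1) (x' : g0) : g1 :=
  - D x' - D' x

/-- Hom-component of `⟦X,(D,x)⟧ = ([X,D]_C + l_X(x,·), X0 x)` for a derivation
triple `(X0,X1,lX)`. -/
def brXD1c (X0 : g0 →ₗ[k] g0) (X1 : g1 →ₗ[k] g1) (lX : g0 →ₗ[k] g0 →ₗ[k] g1)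
    (D : g0 →ₗ[k] g1) (x : g0) : g0 →ₗ[k] g1 :=
  X1 ∘ₗ D - D ∘ₗ X0 + lX x

/-- `⟦X,(D,x)⟧` as a pair in `Hom(g0,g1) × g0`. -/
def brXDc (X0 : g0 →ₗ[k] g0) (X1 : g1 →ₗ[k] g1) (lX : g0 →ₗ[k] g0 →ₗ[k] g1)
    (D : g0 →ₗ[k] g1) (x : g0) : (g0 →ₗ[k] g1) × g0 :=
  (brXD1c X0 X1 lX D x, X0 x)

end LieTwo

open LieTwo

namespace LieTwo

section Bracket

variable {k g0 g1 : Type*} [Field k] [AddCommGroup g0] [Module k g0]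
  [AddCommGroup g1] [Module k g1]

theorem lBc_apply (X0 : g0 →ₗ[k] g0) (X1 : g1 →ₗ[k] g1) (lX : g0 →ₗ[k] g0 →ₗ[k] g1)
    (Y0 : g0 →ₗ[k] g0) (Y1 : g1 →ₗ[k] g1) (lY : g0 →ₗ[k] g0 →ₗ[k] g1) (x y : g0) :
    lBc X0 X1 lX Y0 Y1 lY x y
      = lX (Y0 x) y + lX x (Y0 y) - lY (X0 x) y - lY x (X0 y) + X1 (lY x y) - Y1 (lX x y) :=
  rfl

variable {T : LieTwo k g0 g1}

theorem lB_apply (X Y : T.Der0) (x y : g0) :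
    lB X Y x y = X.lX (Y.X0 x) y + X.lX x (Y.X0 y) - Y.lX (X.X0 x) y - Y.lX x (X.X0 y)
      + X.X1 (Y.lX x y) - Y.X1 (X.lX x y) :=
  rfl

theorem cc0_apply (X Y : T.Der0) (x : g0) : cc0 X Y x = X.X0 (Y.X0 x) - Y.X0 (X.X0 x) :=
  rfl

theorem cc1_apply (X Y : T.Der0) (a : g1) : cc1 X Y a = X.X1 (Y.X1 a) - Y.X1 (X.X1 a) :=
  rfl

namespace Der0

theorem X0_br0 (X : T.Der0) (x y : g0) :
    X.X0 (T.br0 x y) = T.br0 (X.X0 x) y + T.br0 x (X.X0 y) + T.d (X.lX x y) := by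
  rw [← X.conda]; abel

theorem X1_br1 (X : T.Der0) (x : g0) (a : g1) :
    X.X1 (T.br1 x a) = T.br1 (X.X0 x) a + T.br1 x (X.X1 a) + X.lX x (T.d a) := by
  rw [← X.condb]; abel

theorem X1_l3 (X : T.Der0) (x y z : g0) :
    X.X1 (T.l3 x y z) = X.lX x (T.br0 y z) + T.br1 x (X.lX y z) + T.l3 (X.X0 x) y z
      + T.l3 x (X.X0 y) z + T.l3 x y (X.X0 z) - X.lX (T.br0 x y) z - X.lX y (T.br0 x z)
      + T.br1 z (X.lX x y) - T.br1 y (X.lX x z) := by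
  linear_combination (norm := abel) -X.condc x y z

/-- The bracket `([X,Y]_C, l_{[X,Y]_C})` of two derivations of degree 0. -/
def bracket (X Y : T.Der0) : T.Der0 where
  X0 := cc0 X Y
  X1 := cc1 X Y
  lX := lB X Y
  compat a := by simp only [cc0_apply, cc1_apply, X.compat, Y.compat, map_sub]
  lX_skew x y := by
    simp only [lB_apply]
    rw [X.lX_skew x y, Y.lX_skew x y, X.lX_skew x, Y.lX_skew x, X.lX_skew _ y, Y.lX_skew _ y]
    simp only [map_neg]
    abel
  conda x y := by
    simp only [cc0_apply, lB_apply, X0_br0, map_add, map_sub, LinearMap.sub_apply, compat]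
    abel
  condb x a := by
    simp only [cc0_apply, cc1_apply, lB_apply, X1_br1, map_add, map_sub, LinearMap.sub_apply,
      compat]
    abel
  condc x y z := by
    simp only [cc0_apply, cc1_apply, lB_apply, X1_l3, X0_br0, X1_br1, map_add, map_sub,
      LinearMap.add_apply, LinearMap.sub_apply]
    rw [X.lX_skew (T.d _) z, Y.lX_skew (T.d _) z]
    abel

end Der0

end Bracket

end LieTwo

/-- `Der⁰(g)` with the bracket `[(X,l_X),(Y,l_Y)] = ([X,Y]_C, l_{[X,Y]_C})`
is a Lie algebra: the bracket is well defined (closed), skew-symmetric and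
satisfies the Jacobi identity; in particular
`l_{[X,[Y,Z]_C]_C} + l_{[Y,[Z,X]_C]_C} + l_{[Z,[X,Y]_C]_C} = 0`. -/
theorem stmt3 {k g0 g1 : Type*} [Field k] [AddCommGroup g0] [Module k g0]
    [AddCommGroup g1] [Module k g1] (T : LieTwo k g0 g1) :
    -- closure
    (∀ X Y : T.Der0, ∃ Z : T.Der0,
      Z.X0 = cc0 X Y ∧ Z.X1 = cc1 X Y ∧ Z.lX = lB X Y) ∧
    -- skew-symmetry
    (∀ X Y : T.Der0,
      cc0 X Y = - cc0 Y X ∧ cc1 X Y = - cc1 Y X ∧ lB X Y = - lB Y X) ∧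
    -- Jacobi identity, End-components
    (∀ X Y Z : T.Der0,
      (X.X0 ∘ₗ cc0 Y Z - cc0 Y Z ∘ₗ X.X0)
          + (Y.X0 ∘ₗ cc0 Z X - cc0 Z X ∘ₗ Y.X0)
          + (Z.X0 ∘ₗ cc0 X Y - cc0 X Y ∘ₗ Z.X0) = 0 ∧
      (X.X1 ∘ₗ cc1 Y Z - cc1 Y Z ∘ₗ X.X1)
          + (Y.X1 ∘ₗ cc1 Z X - cc1 Z X ∘ₗ Y.X1)
          + (Z.X1 ∘ₗ cc1 X Y - cc1 X Y ∘ₗ Z.X1) = 0) ∧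
    -- Jacobi identity, l-components: l_{[X,[Y,Z]]} + l_{[Y,[Z,X]]} + l_{[Z,[X,Y]]} = 0
    (∀ X Y Z : T.Der0,
      lBc X.X0 X.X1 X.lX (cc0 Y Z) (cc1 Y Z) (lB Y Z)
        + lBc Y.X0 Y.X1 Y.lX (cc0 Z X) (cc1 Z X) (lB Z X)
        + lBc Z.X0 Z.X1 Z.lX (cc0 X Y) (cc1 X Y) (lB X Y) = 0) := by
  refine ⟨fun X Y => ⟨X.bracket Y, rfl, rfl, rfl⟩, fun X Y => ⟨?_, ?_, ?_⟩,
    fun X Y Z => ⟨?_, ?_⟩, fun X Y Z => ?_⟩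
  · ext x
    simp only [cc0_apply, LinearMap.neg_apply]
    abel
  · ext a
    simp only [cc1_apply, LinearMap.neg_apply]
    abel
  · ext x y
    simp only [lB_apply, LinearMap.neg_apply]
    abel
  · ext x
    simp only [cc0_apply, LinearMap.add_apply, LinearMap.sub_apply, LinearMap.comp_apply,
      LinearMap.zero_apply, map_sub]
    abel
  · ext a
    simp only [cc1_apply, LinearMap.add_apply, LinearMap.sub_apply, LinearMap.comp_apply,
      LinearMap.zero_apply, map_sub]
    abel
  · ext x y
    simp only [lBc_apply, lB_apply, cc0_apply, cc1_apply, LinearMap.add_apply,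
      LinearMap.sub_apply, LinearMap.zero_apply, map_add, map_sub]
    abel
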